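/- Let X = (x₁,…,xₙ) be a vector configuration spanning ℝ^d, d ≥ 2, such that every (d−2)-dimensional linear subspace of ℝ^d spanned by a subset of {x₁,…,xₙ} is contained in exactly 2 or 3 (d−1)-dimensional linear subspaces spanned by subsets of {x₁,…,xₙ}. Let L ⊆ ℤⁿ be the lattice generated by the cocircuits of X. Then the set of covectors of X equals the set of sign vectors of L: {(sgn f(x₁),…,sgn f(xₙ)) : f : ℝ^d → ℝ linear} = {(sgn v₁,…,sgn vₙ) : v ∈ L}. -/

import Mathlib

/-- The support of an integer vector: the set of its nonzero coordinates. -/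
def supp {n : ℕ} (v : Fin n → ℤ) : Set (Fin n) := {i | v i ≠ 0}

/-- `v` is an elementary vector of the lattice `L ⊆ ℤⁿ`: it is a nonzero lattice
vector with entries in `{-1,0,+1}` whose support is minimal among supports of
nonzero lattice vectors. -/
def IsElementary {n : ℕ} (L : AddSubgroup (Fin n → ℤ)) (v : Fin n → ℤ) : Prop :=
  v ∈ L ∧ v ≠ 0 ∧ (∀ i, v i = -1 ∨ v i = 0 ∨ v i = 1) ∧
    ∀ u ∈ L, u ≠ 0 → ¬ (supp u ⊂ supp v)

/-- A lattice `L ⊆ ℤⁿ` is zonotopal if every nonzero lattice vector's support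
contains the support of some elementary vector. -/
def IsZonotopal {n : ℕ} (L : AddSubgroup (Fin n → ℤ)) : Prop :=
  ∀ v ∈ L, v ≠ 0 → ∃ u, IsElementary L u ∧ supp u ⊆ supp v

/-- The weighted inner product on `ℝⁿ` with weights `lam`. -/
def wip {n : ℕ} (lam : Fin n → ℝ) (x y : Fin n → ℝ) : ℝ := ∑ i, lam i * x i * y i

/-- Coordinatewise cast of an integer vector to a real vector. -/
def icast {n : ℕ} (v : Fin n → ℤ) : Fin n → ℝ := fun i => (v i : ℝ)

/-- The real span `F` of a lattice `L ⊆ ℤⁿ`. -/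
def latticeSpan {n : ℕ} (L : AddSubgroup (Fin n → ℤ)) : Submodule ℝ (Fin n → ℝ) :=
  Submodule.span ℝ (icast '' (L : Set (Fin n → ℤ)))

/-- The Dirichlet-Voronoi polytope of a lattice `L ⊆ ℤⁿ` with respect to the
weighted inner product with weights `lam`. -/
def DV {n : ℕ} (L : AddSubgroup (Fin n → ℤ)) (lam : Fin n → ℝ) : Set (Fin n → ℝ) :=
  {x | x ∈ latticeSpan L ∧
    ∀ v ∈ L, wip lam x (icast v) ≤ wip lam (icast v) (icast v) / 2}

/-- `v` is a strict Voronoi vector of `L` with respect to the weighted inner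
product with weights `lam`: `±v` are the unique shortest vectors of `v + 2L`. -/
def IsStrictVoronoi {n : ℕ} (L : AddSubgroup (Fin n → ℤ)) (lam : Fin n → ℝ)
    (v : Fin n → ℤ) : Prop :=
  v ∈ L ∧ v ≠ 0 ∧ ∀ w ∈ L, v + 2 • w ≠ v → v + 2 • w ≠ -v →
    wip lam (icast v) (icast v) <
      wip lam (icast (v + 2 • w)) (icast (v + 2 • w))

/-- Two integer vectors are conformal if their entries never have opposite signs. -/
def IsConformal {n : ℕ} (v w : Fin n → ℤ) : Prop := ∀ i, 0 ≤ v i * w i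

/-- The sign of a real number, as an integer in `{-1,0,+1}`. -/
noncomputable def sgnR (t : ℝ) : ℤ := if 0 < t then 1 else if t < 0 then -1 else 0

/-- A covector of the vector configuration `X`: the sign vector of the values of a
linear functional on the configuration. -/
def IsCovector {n d : ℕ} (X : Fin n → Fin d → ℝ) (s : Fin n → ℤ) : Prop :=
  ∃ f : (Fin d → ℝ) →ₗ[ℝ] ℝ, ∀ i, s i = sgnR (f (X i))

/-- A cocircuit of the vector configuration `X`: a nonzero covector of minimal support. -/
def IsCocircuit {n d : ℕ} (X : Fin n → Fin d → ℝ) (s : Fin n → ℤ) : Prop :=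
  IsCovector X s ∧ s ≠ 0 ∧ ∀ t, IsCovector X t → t ≠ 0 → ¬ (supp t ⊂ supp s)

/-- The lattice in `ℤⁿ` generated by the cocircuits of `X`. -/
def cocircuitLattice {n d : ℕ} (X : Fin n → Fin d → ℝ) : AddSubgroup (Fin n → ℤ) :=
  AddSubgroup.closure {s | IsCocircuit X s}

/-- A linear subspace of `ℝ^d` spanned by a subset of the configuration `X`. -/
def SpannedSubspace {n d : ℕ} (X : Fin n → Fin d → ℝ)
    (W : Submodule ℝ (Fin d → ℝ)) : Prop :=
  ∃ S : Set (Fin n), W = Submodule.span ℝ (X '' S)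

/-- McMullen's condition (II): every `(d-2)`-dimensional subspace spanned by vectors
of `X` is contained in exactly `2` or `3` hyperplanes spanned by vectors of `X`. -/
def ConditionII {n d : ℕ} (X : Fin n → Fin d → ℝ) : Prop :=
  ∀ W : Submodule ℝ (Fin d → ℝ), SpannedSubspace X W → Module.finrank ℝ W = d - 2 →
    {H : Submodule ℝ (Fin d → ℝ) |
        SpannedSubspace X H ∧ Module.finrank ℝ H = d - 1 ∧ W ≤ H}.ncard = 2 ∨
    {H : Submodule ℝ (Fin d → ℝ) |
        SpannedSubspace X H ∧ Module.finrank ℝ H = d - 1 ∧ W ≤ H}.ncard = 3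

/-- The zonotope generated by the vector configuration `X`, i.e. the Minkowski sum
of the segments `conv{xᵢ, -xᵢ}`. -/
def zonotope {n d : ℕ} (X : Fin n → Fin d → ℝ) : Set (Fin d → ℝ) :=
  {z | ∃ c : Fin n → ℝ, (∀ i, |c i| ≤ 1) ∧ z = ∑ i, c i • X i}

/-- `P` tiles `ℝ^d` face-to-face by translations: some family of translates of `P`
covers `ℝ^d`, and any two distinct translates intersect in a common (possibly empty)
exposed face. -/
def TilesFaceToFace {d : ℕ} (P : Set (Fin d → ℝ)) : Prop :=
  ∃ T : Set (Fin d → ℝ),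
    (∀ x, ∃ t ∈ T, x ∈ (t + ·) '' P) ∧
    ∀ s ∈ T, ∀ t ∈ T, s ≠ t →
      IsExposed ℝ ((s + ·) '' P) (((s + ·) '' P) ∩ ((t + ·) '' P)) ∧
      IsExposed ℝ ((t + ·) '' P) (((s + ·) '' P) ∩ ((t + ·) '' P))


lemma lemStep {n : ℕ} (u h : Fin n → ℝ) (hsupp : ∀ i, u i = 0 → h i = 0) (i₀ : Fin n)
    (hi₀ : h i₀ * u i₀ < 0) :
    ∃ s : ℝ, 0 < s ∧ (∀ i, 0 ≤ (u i + s * h i) * u i) ∧ ∃ i₁, u i₁ ≠ 0 ∧ u i₁ + s * h i₁ = 0 := by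
  classical
  let T : Finset (Fin n) := Finset.univ.filter (fun i => h i * u i < 0)
  obtain ⟨m, hm, hmin⟩ := T.exists_min_image (fun i => - u i / h i) ⟨i₀, by simp [T, hi₀]⟩
  have hm' : h m * u m < 0 := by simpa [T] using hm
  have hm0 : h m ≠ 0 := by rintro h0; simp [h0] at hm'
  have hu0 : u m ≠ 0 := by rintro h0; simp [h0] at hm'
  have key : ∀ i, h i * u i < 0 → -u i / h i = (u i * u i) / (-(h i * u i)) := by
    intro i hi
    have h1 : h i ≠ 0 := by rintro h0; simp [h0] at hi
    have h2 : u i ≠ 0 := by rintro h0; simp [h0] at hi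
    field_simp
  refine ⟨-u m / h m, ?_, ?_, m, hu0, by field_simp; ring⟩
  · rw [key m hm']
    exact div_pos (mul_self_pos.2 hu0) (by linarith)
  · have hs : 0 < -u m / h m := by
      rw [key m hm']
      exact div_pos (mul_self_pos.2 hu0) (by linarith)
    intro i
    by_cases hi : h i * u i < 0
    · have := hmin i (by simp [T, hi])
      rw [key i hi, le_div_iff₀ (by linarith)] at this
      nlinarith
    · push Not at hi
      have := mul_nonneg hs.le hi
      nlinarith [mul_self_nonneg (u i)]

lemma lemB {n : ℕ} (U : Submodule ℝ (Fin n → ℝ)) : ∀ (k : ℕ) (u : Fin n → ℝ), u ∈ U →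
    ∀ j, u j ≠ 0 → {i | u i ≠ 0}.ncard ≤ k →
    ∃ g ∈ U, g j ≠ 0 ∧ (∀ i, 0 ≤ g i * u i) ∧ (∀ i, u i = 0 → g i = 0) ∧
      ∀ h ∈ U, h ≠ 0 → (∀ i, g i = 0 → h i = 0) → ∀ i, h i = 0 → g i = 0 := by
  intro k
  induction k with
  | zero =>
    intro u _ j hj hk
    have : {i | u i ≠ 0} = ∅ := by
      rw [← Set.ncard_eq_zero]; omega
    exact absurd hj (by simpa using Set.eq_empty_iff_forall_notMem.1 this j)
  | succ k ih =>
    intro u hu j hj hk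
    -- transfer of smaller conformal vectors
    have trans : ∀ w ∈ U, w j ≠ 0 → (∀ i, 0 ≤ w i * u i) → (∀ i, u i = 0 → w i = 0) →
        (∃ i, u i ≠ 0 ∧ w i = 0) → ∃ g ∈ U, g j ≠ 0 ∧ (∀ i, 0 ≤ g i * u i) ∧
        (∀ i, u i = 0 → g i = 0) ∧
        ∀ h ∈ U, h ≠ 0 → (∀ i, g i = 0 → h i = 0) → ∀ i, h i = 0 → g i = 0 := by
      intro w hw hwj hwu hw0 ⟨i₁, h1, h2⟩
      have hlt : {i | w i ≠ 0}.ncard < {i | u i ≠ 0}.ncard := by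
        apply Set.ncard_lt_ncard _ (Set.toFinite _)
        refine ⟨fun i hi h => hi (hw0 i h), fun hh => ?_⟩
        exact hh h1 h2
      obtain ⟨g, hg, hgj, hgc, hg0, hmin⟩ := ih w hw j hwj (by omega)
      refine ⟨g, hg, hgj, ?_, fun i hi => hg0 i (hw0 i hi), hmin⟩
      intro i
      by_cases hwi : w i = 0
      · simp [hg0 i hwi]
      · have a := hgc i
        have b := hwu i
        have : 0 < w i * w i := mul_self_pos.2 hwi
        by_contra hneg
        push Not at hneg
        nlinarith [mul_nonneg a b]
    -- case 1
    have case1 : ∀ h ∈ U, (∀ i, u i = 0 → h i = 0) → 0 ≤ h j * u j → (∃ i, h i * u i < 0) →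
        ∃ g ∈ U, g j ≠ 0 ∧ (∀ i, 0 ≤ g i * u i) ∧
        (∀ i, u i = 0 → g i = 0) ∧
        ∀ h ∈ U, h ≠ 0 → (∀ i, g i = 0 → h i = 0) → ∀ i, h i = 0 → g i = 0 := by
      intro h hh hsupp hj' ⟨i₀, hi₀⟩
      obtain ⟨s, hs, hc, i₁, h1, h2⟩ := lemStep u h hsupp i₀ hi₀
      refine trans (u + s • h) (U.add_mem hu (U.smul_mem s hh)) ?_ ?_ ?_ ⟨i₁, h1, by simpa using h2⟩
      · intro h0
        simp at h0
        have : 0 < u j * u j := mul_self_pos.2 hj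
        have h3 : (u j + s * h j) * u j = 0 := by rw [h0]; simp
        nlinarith [mul_nonneg hs.le hj']
      · simpa using hc
      · intro i hi; simp [hi, hsupp i hi]
    by_cases hel : ∀ h ∈ U, h ≠ 0 → (∀ i, u i = 0 → h i = 0) → ∀ i, h i = 0 → u i = 0
    · exact ⟨u, hu, hj, fun i => mul_self_nonneg _, fun i h => h, hel⟩
    push Not at hel
    obtain ⟨h₀, hh₀, hne₀, hs₀, i₁, hi₁, hui₁⟩ := hel
    obtain ⟨h, hh, hne, hs, hi, hpos⟩ : ∃ h ∈ U, h ≠ 0 ∧ (∀ i, u i = 0 → h i = 0) ∧ h i₁ = 0 ∧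
        0 ≤ h j * u j := by
      rcases le_total 0 (h₀ j * u j) with hp | hp
      · exact ⟨h₀, hh₀, hne₀, hs₀, hi₁, hp⟩
      · exact ⟨-h₀, U.neg_mem hh₀, by simpa using hne₀, by simpa using hs₀, by simpa using hi₁,
          by simp; linarith⟩
    by_cases hex : ∃ i, h i * u i < 0
    · exact case1 h hh hs hpos hex
    push Not at hex
    by_cases hjz : h j = 0
    · refine case1 (-h) (U.neg_mem hh) (by simpa using hs) (by simp [hjz]) ?_
      obtain ⟨i, hi'⟩ := Function.ne_iff.1 hne
      simp at hi'
      refine ⟨i, ?_⟩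
      have : u i ≠ 0 := fun h0 => hi' (hs i h0)
      have h1 := hex i
      have h2 : h i * u i ≠ 0 := mul_ne_zero hi' this
      have : 0 < h i * u i := lt_of_le_of_ne h1 h2.symm
      simp; linarith
    · exact trans h hh hjz hex hs ⟨i₁, hui₁, hi⟩

lemma sgnR_eq_sign (t : ℝ) : sgnR t = ((SignType.sign t : SignType) : ℤ) := by
  unfold sgnR
  rcases lt_trichotomy t 0 with h | h | h
  · simp [h, h.le, not_lt.2 h.le]
  · simp [h]
  · simp [h]

lemma sgnR_pos {t : ℝ} (h : 0 < t) : sgnR t = 1 := by simp [sgnR, h]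
lemma sgnR_neg {t : ℝ} (h : t < 0) : sgnR t = -1 := by simp [sgnR, h, not_lt.2 h.le]
lemma sgnR_zero : sgnR 0 = 0 := by simp [sgnR]
lemma sgnR_eq_zero {t : ℝ} : sgnR t = 0 ↔ t = 0 := by
  rcases lt_trichotomy t 0 with h | h | h
  · simp [sgnR_neg h, h.ne]
  · simp [h, sgnR_zero]
  · simp [sgnR_pos h, h.ne']

lemma sgnR_add {a b : ℝ} (h : a + b = 0 ∨ a = 0 ∨ b = 0) : sgnR (a + b) = sgnR a + sgnR b := by
  rcases h with h | h | h
  · obtain rfl : b = -a := by linarith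
    rcases lt_trichotomy a 0 with h | h | h
    · rw [sgnR_neg h, sgnR_pos (by linarith : 0 < -a)]; simp [sgnR_zero]
    · simp [h, sgnR_zero]
    · rw [sgnR_pos h, sgnR_neg (by linarith : -a < 0)]; simp [sgnR_zero]
  · simp [h, sgnR_zero]
  · simp [h, sgnR_zero]

lemma sgnR_mul (a b : ℝ) : sgnR (a * b) = sgnR a * sgnR b := by
  simp [sgnR_eq_sign, sign_mul]

lemma farkas {n d : ℕ} (X : Fin n → Fin d → ℝ) (v : Fin n → ℤ)
    (hv : ∀ y : Fin n → ℝ, ∑ i, y i • X i = 0 → (∀ i, 0 ≤ y i * v i) → ∀ i, y i * v i = 0) :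
    ∃ f : (Fin d → ℝ) →ₗ[ℝ] ℝ, ∀ i, Int.sign (v i) = sgnR (f (X i)) := by
  classical
  let A : (Fin n → ℝ) →ₗ[ℝ] (Fin d → ℝ) := Fintype.linearCombination ℝ X
  have hA : ∀ c, A c = ∑ i, c i • X i := fun c => Fintype.linearCombination_apply ..
  let S : Set (Fin n → ℝ) := {c | ∑ i, c i * v i = 1 ∧ (∀ i, 0 ≤ c i * v i) ∧ ∀ i, v i = 0 → c i = 0}
  let Z : Submodule ℝ (Fin n → ℝ) :=
    { carrier := {c | ∀ i, v i ≠ 0 → c i = 0}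
      add_mem' := by intro a b ha hb i hi; simp [ha i hi, hb i hi]
      zero_mem' := by intro i _; rfl
      smul_mem' := by intro r a ha i hi; simp [ha i hi] }
  have hSconv : Convex ℝ S := by
    rintro a ⟨ha1, ha2, ha3⟩ b ⟨hb1, hb2, hb3⟩ s t hs ht hst
    refine ⟨?_, ?_, ?_⟩
    · have : ∀ i, (s • a + t • b) i * (v i : ℝ) = s * (a i * v i) + t * (b i * v i) := by
        intro i; simp; ring
      simp only [this, Finset.sum_add_distrib, ← Finset.mul_sum, ha1, hb1]; linarith
    · intro i
      have : (s • a + t • b) i * (v i : ℝ) = s * (a i * v i) + t * (b i * v i) := by simp; ring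
      rw [this]
      exact add_nonneg (mul_nonneg hs (ha2 i)) (mul_nonneg ht (hb2 i))
    · intro i hi; simp [ha3 i hi, hb3 i hi]
  have hScl : IsClosed S := by
    have : S = {c : Fin n → ℝ | ∑ i, c i * v i = 1} ∩ ((⋂ i, {c : Fin n → ℝ | 0 ≤ c i * v i}) ∩
        ⋂ i, ⋂ (_ : v i = 0), {c : Fin n → ℝ | c i = 0}) := by
      ext c; simp [S]
    rw [this]
    refine (isClosed_eq (by fun_prop) (by fun_prop)).inter ((isClosed_iInter fun i =>
      isClosed_le (by fun_prop) (by fun_prop)).inter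
      (isClosed_iInter fun i => isClosed_iInter fun _ => isClosed_eq (by fun_prop) (by fun_prop)))
  have hSb : S ⊆ Set.Icc (fun _ => -1) (fun _ => 1) := by
    rintro c ⟨h1, h2, h3⟩
    have : ∀ i, |c i| ≤ 1 := by
      intro i
      by_cases hi : v i = 0
      · simp [h3 i hi]
      · have h4 : c i * v i ≤ 1 := h1 ▸ Finset.single_le_sum (f := fun i => c i * (v i : ℝ)) (fun i _ => h2 i) (Finset.mem_univ i)
        have h5 : |c i| * |(v i : ℝ)| ≤ 1 := by rw [← abs_mul, abs_of_nonneg (h2 i)]; exact h4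
        have h6 : (1 : ℝ) ≤ |(v i : ℝ)| := by exact_mod_cast Int.one_le_abs hi
        nlinarith [abs_nonneg (c i)]
    exact ⟨fun i => (abs_le.1 (this i)).1, fun i => (abs_le.1 (this i)).2⟩
  have hScomp : IsCompact S := isCompact_Icc.of_isClosed_subset hScl hSb
  have hAcont : Continuous A := A.continuous_of_finiteDimensional
  have hdisj : Disjoint (A '' S) (Z.map A : Set (Fin d → ℝ)) := by
    rw [Set.disjoint_left]
    rintro _ ⟨c, ⟨h1, h2, h3⟩, rfl⟩ hz
    obtain ⟨z, hz, hzc⟩ := hz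
    have key := hv (c - z) (by rw [← hA, map_sub, hzc, sub_self]) (by
      intro i
      by_cases hi : v i = 0
      · simp [hi]
      · simpa [hz i hi] using h2 i)
    have : ∑ i, c i * (v i : ℝ) = 0 := by
      apply Finset.sum_eq_zero
      intro i _
      by_cases hi : v i = 0
      · simp [hi]
      · have := key i
        simpa [hz i hi] using this
    linarith
  obtain ⟨f, a, b, hfa, hab, hfb⟩ := geometric_hahn_banach_compact_closed
    (hSconv.linear_image A) (hScomp.image hAcont) (Z.map A).convex
    (Z.map A).closed_of_finiteDimensional hdisj
  have hb0 : b < 0 := by simpa using hfb 0 (Z.map A).zero_mem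
  have hfz : ∀ w ∈ Z.map A, f w = 0 := by
    intro w hw
    by_contra hne
    have := hfb ((b / f w) • w) ((Z.map A).smul_mem _ hw)
    simp [div_mul_cancel₀ _ hne] at this
  refine ⟨-(f : (Fin d → ℝ) →ₗ[ℝ] ℝ), fun i => ?_⟩
  have hsing : ∀ r : ℝ, A (Pi.single i r) = r • X i := by
    intro r; simp [A]
  by_cases hi : v i = 0
  · have : f (X i) = 0 := by
      apply hfz
      refine ⟨Pi.single i 1, ?_, by simp [hsing]⟩
      intro k hk
      have : k ≠ i := by rintro rfl; exact hk hi
      simp [this]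
    simp [hi, this, sgnR_zero]
  · have hi' : (v i : ℝ) ≠ 0 := by exact_mod_cast hi
    have hm : Pi.single i ((v i : ℝ)⁻¹) ∈ S := by
      refine ⟨?_, ?_, ?_⟩
      · rw [Finset.sum_eq_single i]
        · simp [hi']
        · intro k _ hk; simp [hk]
        · simp
      · intro k
        by_cases hk : k = i
        · subst hk; simp [hi']
        · simp [hk]
      · intro k hk
        have : k ≠ i := by rintro rfl; exact hi hk
        simp [this]
    have h1 := hfa _ ⟨_, hm, rfl⟩
    rw [hsing, map_smul, smul_eq_mul] at h1
    have h2 : (v i : ℝ)⁻¹ * f (X i) < 0 := by linarith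
    rcases lt_or_gt_of_ne hi with hneg | hpos
    · have h3 : (v i : ℝ)⁻¹ < 0 := inv_lt_zero.2 (by exact_mod_cast hneg)
      have h4 : 0 < f (X i) := by
        by_contra h; push Not at h
        nlinarith [mul_nonneg_of_nonpos_of_nonpos h3.le h]
      rw [Int.sign_eq_neg_one_of_neg hneg, sgnR_neg]
      simpa using h4
    · have h3 : 0 < (v i : ℝ)⁻¹ := inv_pos.2 (by exact_mod_cast hpos)
      have h4 : f (X i) < 0 := by
        by_contra h; push Not at h
        nlinarith [mul_nonneg h3.le h]
      rw [Int.sign_eq_one_of_pos hpos, sgnR_pos]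
      simpa using h4

lemma four_elems {α : Type*} {F : Set α} (hF : F.ncard = 2 ∨ F.ncard = 3) {a b c e : α}
    (ha : a ∈ F) (hb : b ∈ F) (hc : c ∈ F) (he : e ∈ F) (hab : a ≠ b) (hac : a ≠ c) (hbc : b ≠ c)
    (hae : a ≠ e) (hbe : b ≠ e) (hce : c ≠ e) : False := by
  classical
  have hfin : F.Finite := Set.finite_of_ncard_ne_zero (by omega)
  have hsub : ((({a, b, c, e} : Finset α) : Set α)) ⊆ F := by
    intro x hx
    simp at hx
    rcases hx with rfl | rfl | rfl | rfl <;> assumption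
  have h1 := Set.ncard_le_ncard hsub hfin
  rw [Set.ncard_coe_finset] at h1
  have h2 : ({a, b, c, e} : Finset α).card = 4 := by
    simp [Finset.card_insert_of_notMem, hab, hac, hae, hbc, hbe, hce]
  omega

lemma finrank_indep {n d : ℕ} {X : Fin n → Fin d → ℝ} {S : Set (Fin n)}
    (h : LinearIndepOn ℝ X S) : Module.finrank ℝ (Submodule.span ℝ (X '' S)) = S.ncard := by
  classical
  have := finrank_span_eq_card (R := ℝ) h
  rw [Set.image_eq_range, this, ← Nat.card_eq_fintype_card, Nat.card_coe_set_eq]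

lemma finrank_ker' {d : ℕ} {f : (Fin d → ℝ) →ₗ[ℝ] ℝ} (hf : f ≠ 0) :
    Module.finrank ℝ (LinearMap.ker f) = d - 1 := by
  have := Module.Dual.finrank_ker_add_one_of_ne_zero (f := f) hf
  simp at this
  omega

lemma exists_functional {d : ℕ} (hd : 1 ≤ d) (H : Submodule ℝ (Fin d → ℝ))
    (hH : Module.finrank ℝ H = d - 1) :
    ∃ g : (Fin d → ℝ) →ₗ[ℝ] ℝ, g ≠ 0 ∧ LinearMap.ker g = H := by
  have hlt : H < ⊤ := by
    rw [lt_top_iff_ne_top]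
    rintro rfl
    simp at hH
    omega
  obtain ⟨g, hg, hle⟩ := Submodule.exists_le_ker_of_lt_top H hlt
  exact ⟨g, hg, (Submodule.eq_of_le_of_finrank_eq hle (by rw [hH, finrank_ker' hg])).symm⟩

lemma zero_of_ker {d : ℕ} {g h : (Fin d → ℝ) →ₗ[ℝ] ℝ} {x : Fin d → ℝ} (hg : g ≠ 0)
    (hle : LinearMap.ker g ≤ LinearMap.ker h) (hx : g x ≠ 0) (hhx : h x = 0) : h = 0 := by
  apply LinearMap.ext
  intro y
  have : y - (g y / g x) • x ∈ LinearMap.ker g := by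
    simp [div_mul_cancel₀ _ hx]
  have := hle this
  simpa [hhx] using this

/-- Splitting a cocircuit functional along a coline. -/
lemma split_cocircuit {n d : ℕ} (hd : 2 ≤ d) (X : Fin n → Fin d → ℝ) (hII : ConditionII X)
    (B : Set (Fin n)) (hB : LinearIndepOn ℝ X B) (hBs : Submodule.span ℝ (X '' B) = ⊤)
    (f : (Fin d → ℝ) →ₗ[ℝ] ℝ) (hf : f ≠ 0) (hfs : SpannedSubspace X (LinearMap.ker f))
    (c₁ c₂ : Fin n) (hc : c₁ ≠ c₂) (hc₁ : c₁ ∈ B) (hc₂ : c₂ ∈ B) (hfc₁ : f (X c₁) ≠ 0)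
    (hfc₂ : f (X c₂) ≠ 0) :
    ∃ f₁ f₂ : (Fin d → ℝ) →ₗ[ℝ] ℝ, f₁ ≠ 0 ∧ f₂ ≠ 0 ∧ SpannedSubspace X (LinearMap.ker f₁) ∧
      SpannedSubspace X (LinearMap.ker f₂) ∧
      {b | b ∈ B ∧ f₁ (X b) ≠ 0} ⊂ {b | b ∈ B ∧ f (X b) ≠ 0} ∧
      {b | b ∈ B ∧ f₂ (X b) ≠ 0} ⊂ {b | b ∈ B ∧ f (X b) ≠ 0} ∧
      ∀ i, sgnR (f (X i)) = sgnR (f₁ (X i)) + sgnR (f₂ (X i)) := by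
  classical
  have hBcard : B.ncard = d := by
    rw [← finrank_indep hB, hBs]; simp
  obtain ⟨S, hS⟩ := hfs
  have hS0 : ∀ i ∈ S, f (X i) = 0 := by
    intro i hi
    have : X i ∈ LinearMap.ker f := hS ▸ Submodule.subset_span ⟨i, hi, rfl⟩
    simpa using this
  let B0 : Set (Fin n) := {b | b ∈ B ∧ f (X b) = 0}
  obtain ⟨B', hB'sub, hB0B', hB'span, hB'⟩ := exists_linearIndepOn_extension
    (K := ℝ) (v := X) (s := B0) (t := {i | f (X i) = 0}) (hB.mono fun b hb => hb.1) (fun b hb => hb.2)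
  have hB'ker : Submodule.span ℝ (X '' B') = LinearMap.ker f := by
    apply le_antisymm
    · rw [Submodule.span_le]
      rintro _ ⟨i, hi, rfl⟩
      simpa using hB'sub hi
    · rw [hS, Submodule.span_le]
      rintro _ ⟨i, hi, rfl⟩
      exact hB'span ⟨i, hS0 i hi, rfl⟩
  have hB'card : B'.ncard = d - 1 := by
    rw [← finrank_indep hB', hB'ker, finrank_ker' hf]
  have hB0card : B0.ncard ≤ d - 2 := by
    have h1 : B0 ⊆ B \ {c₁, c₂} := by
      rintro b ⟨hb, hb0⟩
      refine ⟨hb, ?_⟩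
      rintro (rfl | rfl)
      · exact hfc₁ hb0
      · exact hfc₂ hb0
    have h2 := Set.ncard_le_ncard h1 (Set.toFinite _)
    rw [Set.ncard_sdiff (by rintro _ (rfl | rfl) <;> assumption) (Set.toFinite _), Set.ncard_pair hc] at h2
    omega
  obtain ⟨b', hb'B', hb'B0⟩ : ∃ b' ∈ B', b' ∉ B0 := by
    by_contra hcon
    push Not at hcon
    have := Set.ncard_le_ncard (show B' ⊆ B0 from hcon) (Set.toFinite _)
    omega
  let W0 : Set (Fin n) := B' \ {b'}
  have hW0 : LinearIndepOn ℝ X W0 := hB'.mono Set.sdiff_subset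
  have hW0card : W0.ncard = d - 2 := by
    have := Set.ncard_sdiff_singleton_of_mem hb'B'
    show (B' \ {b'}).ncard = d - 2
    omega
  have hB0W0 : B0 ⊆ W0 := fun b hb => ⟨hB0B' hb, by rintro rfl; exact hb'B0 hb⟩
  let W := Submodule.span ℝ (X '' W0)
  have hWf : W ≤ LinearMap.ker f := by
    rw [← hB'ker]; exact Submodule.span_mono (Set.image_mono Set.sdiff_subset)
  let Hy : Fin n → Submodule ℝ (Fin d → ℝ) := fun i => Submodule.span ℝ (X '' insert i W0)
  have hXHy : ∀ i, X i ∈ Hy i := fun i => Submodule.subset_span ⟨i, Set.mem_insert _ _, rfl⟩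
  have hWHy : ∀ i, W ≤ Hy i := fun i => Submodule.span_mono (Set.image_mono (Set.subset_insert _ _))
  have hHyle : ∀ i (H : Submodule ℝ (Fin d → ℝ)), W ≤ H → X i ∈ H → Hy i ≤ H := by
    intro i H hH hi
    rw [Submodule.span_le]
    rintro _ ⟨k, (rfl | hk), rfl⟩
    · exact hi
    · exact hH (Submodule.subset_span ⟨k, hk, rfl⟩)
  have hHyrank : ∀ i, X i ∉ W → Module.finrank ℝ (Hy i) = d - 1 := by
    intro i hi
    have hiW : i ∉ W0 := fun h => hi (Submodule.subset_span ⟨i, h, rfl⟩)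
    rw [finrank_indep (hW0.insert hi), Set.ncard_insert_of_notMem hiW]
    omega
  have hF := hII W ⟨W0, rfl⟩ (by rw [finrank_indep hW0, hW0card])
  have hHymem : ∀ i, X i ∉ W → Hy i ∈ {H : Submodule ℝ (Fin d → ℝ) |
        SpannedSubspace X H ∧ Module.finrank ℝ H = d - 1 ∧ W ≤ H} :=
    fun i hi => ⟨⟨_, rfl⟩, hHyrank i hi, hWHy i⟩
  have hkmem : LinearMap.ker f ∈ {H : Submodule ℝ (Fin d → ℝ) |
        SpannedSubspace X H ∧ Module.finrank ℝ H = d - 1 ∧ W ≤ H} :=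
    ⟨⟨S, hS⟩, finrank_ker' hf, hWf⟩
  have hnW : ∀ i, f (X i) ≠ 0 → X i ∉ W := fun i hi hw => hi (by simpa using hWf hw)
  -- second element
  obtain ⟨b₂, hb₂, hb₂H⟩ : ∃ b ∈ B, X b ∉ Hy c₁ := by
    by_contra hcon
    push Not at hcon
    have : (⊤ : Submodule ℝ (Fin d → ℝ)) ≤ Hy c₁ := by
      rw [← hBs, Submodule.span_le]
      rintro _ ⟨b, hb, rfl⟩
      exact hcon b hb
    have h1 := hHyrank c₁ (hnW c₁ hfc₁)
    rw [top_le_iff.1 this] at h1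
    simp at h1
    omega
  have hfb₂ : f (X b₂) ≠ 0 := by
    intro h0
    exact hb₂H (hWHy _ (Submodule.subset_span ⟨b₂, hB0W0 ⟨hb₂, h0⟩, rfl⟩))
  have hc₁H₂ : X c₁ ∉ Hy b₂ := by
    intro h
    have h1 := hHyle c₁ (Hy b₂) (hWHy _) h
    have h2 := Submodule.eq_of_le_of_finrank_eq h1
      (by rw [hHyrank _ (hnW c₁ hfc₁), hHyrank _ (hnW b₂ hfb₂)])
    exact hb₂H (h2 ▸ hXHy b₂)
  have hcover : ∀ i, f (X i) = 0 ∨ X i ∈ Hy c₁ ∨ X i ∈ Hy b₂ := by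
    intro i
    by_contra hcon
    push Not at hcon
    obtain ⟨h1, h2, h3⟩ := hcon
    have hne : ∀ j, f (X j) ≠ 0 → LinearMap.ker f ≠ Hy j := by
      intro j hj h
      have : X j ∈ LinearMap.ker f := h ▸ hXHy j
      exact hj (by simpa using this)
    exact four_elems hF hkmem (hHymem c₁ (hnW _ hfc₁)) (hHymem b₂ (hnW _ hfb₂))
      (hHymem i (hnW _ h1)) (hne _ hfc₁) (hne _ hfb₂) (fun h => hb₂H (h ▸ hXHy b₂)) (hne _ h1)
      (fun h => h2 (h ▸ hXHy i)) (fun h => h3 (h ▸ hXHy i))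
  obtain ⟨g₁, hg₁, hk₁⟩ := exists_functional (by omega) (Hy c₁) (hHyrank _ (hnW _ hfc₁))
  obtain ⟨g₂, hg₂, hk₂⟩ := exists_functional (by omega) (Hy b₂) (hHyrank _ (hnW _ hfb₂))
  have m₁ : ∀ x, g₁ x = 0 ↔ x ∈ Hy c₁ := fun x => by rw [← hk₁]; simp
  have m₂ : ∀ x, g₂ x = 0 ↔ x ∈ Hy b₂ := fun x => by rw [← hk₂]; simp
  have n₁ : g₁ (X b₂) ≠ 0 := fun h => hb₂H ((m₁ _).1 h)
  have n₂ : g₂ (X c₁) ≠ 0 := fun h => hc₁H₂ ((m₂ _).1 h)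
  have z₁ : g₁ (X c₁) = 0 := (m₁ _).2 (hXHy _)
  have z₂ : g₂ (X b₂) = 0 := (m₂ _).2 (hXHy _)
  let α := f (X b₂) / g₁ (X b₂)
  let β := f (X c₁) / g₂ (X c₁)
  have hα : α ≠ 0 := div_ne_zero hfb₂ n₁
  have hβ : β ≠ 0 := div_ne_zero hfc₁ n₂
  have hdec : f - α • g₁ - β • g₂ = 0 := by
    apply zero_of_ker hg₁ _ n₁
    · simp [z₂, α, div_mul_cancel₀ _ n₁]
    · rw [hk₁]
      apply hHyle
      · intro w hw
        have a1 : f w = 0 := by simpa using hWf hw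
        have a2 : g₁ w = 0 := (m₁ _).2 (hWHy _ hw)
        have a3 : g₂ w = 0 := (m₂ _).2 (hWHy _ hw)
        simp [a1, a2, a3]
      · simp [z₁, β, div_mul_cancel₀ _ n₂]
  have hdec' : ∀ x, f x = (α • g₁) x + (β • g₂) x := by
    intro x
    have := LinearMap.congr_fun hdec x
    simp at this ⊢
    linarith
  have k₁ : LinearMap.ker (α • g₁) = Hy c₁ := by rw [LinearMap.ker_smul _ _ hα, hk₁]
  have k₂ : LinearMap.ker (β • g₂) = Hy b₂ := by rw [LinearMap.ker_smul _ _ hβ, hk₂]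
  refine ⟨α • g₁, β • g₂, smul_ne_zero hα hg₁, smul_ne_zero hβ hg₂, k₁ ▸ ⟨_, rfl⟩, k₂ ▸ ⟨_, rfl⟩,
    ?_, ?_, ?_⟩
  · refine ⟨?_, fun h => ?_⟩
    · rintro b ⟨hb, hb1⟩
      refine ⟨hb, fun h0 => hb1 ?_⟩
      have : g₁ (X b) = 0 := (m₁ _).2 (hWHy _ (Submodule.subset_span ⟨b, hB0W0 ⟨hb, h0⟩, rfl⟩))
      simp [this]
    · exact (h (show c₁ ∈ _ from ⟨hc₁, hfc₁⟩)).2 (by simp [z₁])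
  · refine ⟨?_, fun h => ?_⟩
    · rintro b ⟨hb, hb1⟩
      refine ⟨hb, fun h0 => hb1 ?_⟩
      have : g₂ (X b) = 0 := (m₂ _).2 (hWHy _ (Submodule.subset_span ⟨b, hB0W0 ⟨hb, h0⟩, rfl⟩))
      simp [this]
    · exact (h (show b₂ ∈ _ from ⟨hb₂, hfb₂⟩)).2 (by simp [z₂])
  · intro i
    rw [hdec' (X i)]
    apply sgnR_add
    rcases hcover i with h | h | h
    · left; rw [← hdec', h]
    · right; left; simp [(m₁ _).2 h]
    · right; right; simp [(m₂ _).2 h]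

/-- Orthogonality of a circuit and the cocircuits. -/
lemma orth {n d : ℕ} (hd : 2 ≤ d) (X : Fin n → Fin d → ℝ) (hII : ConditionII X)
    (B : Set (Fin n)) (hB : LinearIndepOn ℝ X B) (hBs : Submodule.span ℝ (X '' B) = ⊤)
    (y : Fin n → ℝ) (hy : ∑ i, y i • X i = 0) (e : Fin n) (he : e ∉ B)
    (hyB : ∀ i, y i ≠ 0 → i = e ∨ i ∈ B) : ∀ (k : ℕ) (f : (Fin d → ℝ) →ₗ[ℝ] ℝ), f ≠ 0 →
    SpannedSubspace X (LinearMap.ker f) → {b | b ∈ B ∧ f (X b) ≠ 0}.ncard ≤ k →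
    ∑ i, sgnR (y i) * sgnR (f (X i)) = 0 := by
  classical
  intro k
  induction k with
  | zero =>
    intro f hf hfs hk
    exfalso
    have h0 : {b | b ∈ B ∧ f (X b) ≠ 0} = ∅ := by rw [← Set.ncard_eq_zero]; omega
    apply hf
    have : (⊤ : Submodule ℝ (Fin d → ℝ)) ≤ LinearMap.ker f := by
      rw [← hBs, Submodule.span_le]
      rintro _ ⟨b, hb, rfl⟩
      by_contra h
      exact Set.eq_empty_iff_forall_notMem.1 h0 b ⟨hb, by simpa using h⟩
    exact LinearMap.ker_eq_top.1 (top_le_iff.1 this)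
  | succ k ih =>
    intro f hf hfs hk
    by_cases h2 : ∃ c₁ c₂, c₁ ≠ c₂ ∧ c₁ ∈ B ∧ c₂ ∈ B ∧ f (X c₁) ≠ 0 ∧ f (X c₂) ≠ 0
    · obtain ⟨c₁, c₂, hc, hc₁, hc₂, hf₁, hf₂⟩ := h2
      obtain ⟨f₁, f₂, a1, a2, a3, a4, a5, a6, a7⟩ :=
        split_cocircuit hd X hII B hB hBs f hf hfs c₁ c₂ hc hc₁ hc₂ hf₁ hf₂
      have l1 := Set.ncard_lt_ncard a5 (Set.toFinite _)
      have l2 := Set.ncard_lt_ncard a6 (Set.toFinite _)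
      have e1 := ih f₁ a1 a3 (by omega)
      have e2 := ih f₂ a2 a4 (by omega)
      simp only [a7, mul_add, Finset.sum_add_distrib, e1, e2, add_zero]
    · push Not at h2
      have hsum : ∑ i, y i * f (X i) = 0 := by
        have := congrArg f hy
        simpa using this
      by_cases hb : ∃ b ∈ B, f (X b) ≠ 0
      · obtain ⟨b, hbB, hbf⟩ := hb
        have hbe : b ≠ e := by rintro rfl; exact he hbB
        have hz : ∀ i, i ≠ b ∧ i ≠ e → y i * f (X i) = 0 := by
          rintro i ⟨hib, hie⟩
          by_cases hyi : y i = 0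
          · simp [hyi]
          · have hiB := (hyB i hyi).resolve_left hie
            have : f (X i) = 0 := by
              by_contra h
              exact hbf (h2 i b hib hiB hbB h)
            simp [this]
        have h3 : y b * f (X b) + y e * f (X e) = 0 := by
          rw [← hsum, Fintype.sum_eq_add b e hbe hz]
        simp only [← sgnR_mul]
        rw [Fintype.sum_eq_add b e hbe (fun i hi => by rw [hz i hi, sgnR_zero]),
          ← sgnR_add (Or.inl h3), h3, sgnR_zero]
      · push Not at hb
        have hz : ∀ i, i ≠ e → y i * f (X i) = 0 := by
          intro i hie
          by_cases hyi : y i = 0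
          · simp [hyi]
          · simp [hb i ((hyB i hyi).resolve_left hie)]
        simp only [← sgnR_mul]
        rw [Fintype.sum_eq_single e (fun i hi => by rw [hz i hi, sgnR_zero])]
        rw [Fintype.sum_eq_single e hz] at hsum
        rw [hsum, sgnR_zero]

lemma functional_ne {n d : ℕ} {X : Fin n → Fin d → ℝ} (hX : Submodule.span ℝ (Set.range X) = ⊤)
    {g : (Fin d → ℝ) →ₗ[ℝ] ℝ} (hg : g ≠ 0) : ∃ i, g (X i) ≠ 0 := by
  by_contra h
  push Not at h
  apply hg
  have : (⊤ : Submodule ℝ (Fin d → ℝ)) ≤ LinearMap.ker g := by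
    rw [← hX, Submodule.span_le]
    rintro _ ⟨b, rfl⟩
    simpa using h b
  exact LinearMap.ker_eq_top.1 (top_le_iff.1 this)

lemma cocircuit_spanned {n d : ℕ} {X : Fin n → Fin d → ℝ}
    (hX : Submodule.span ℝ (Set.range X) = ⊤) {s : Fin n → ℤ} (hs : IsCocircuit X s) :
    ∃ f : (Fin d → ℝ) →ₗ[ℝ] ℝ, f ≠ 0 ∧ SpannedSubspace X (LinearMap.ker f) ∧
      ∀ i, s i = sgnR (f (X i)) := by
  obtain ⟨⟨f, hf⟩, hne, hmin⟩ := hs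
  obtain ⟨j, hj⟩ := Function.ne_iff.1 hne
  have hfj : f (X j) ≠ 0 := by
    intro h; apply hj; rw [hf, h, sgnR_zero]; rfl
  refine ⟨f, by rintro rfl; simp at hfj, ⟨{i | f (X i) = 0}, ?_⟩, hf⟩
  apply le_antisymm
  · intro p hp
    by_contra hpV
    obtain ⟨g, hgp, hg⟩ := Submodule.exists_le_ker_of_notMem hpV
    have hp' : f p = 0 := by simpa using hp
    let g' := g - (g (X j) / f (X j)) • f
    have hg'p : g' p ≠ 0 := by simpa [g', hp'] using hgp
    have hg'j : g' (X j) = 0 := by simp [g', div_mul_cancel₀ _ hfj]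
    have hg'0 : ∀ i, f (X i) = 0 → g' (X i) = 0 := by
      intro i hi
      have : g (X i) = 0 := by
        have := hg (Submodule.subset_span ⟨i, hi, rfl⟩)
        simpa using this
      simp [g', this, hi]
    obtain ⟨i, hi⟩ := functional_ne hX (g := g') (by rintro h; simp [h] at hg'p)
    refine hmin (fun i => sgnR (g' (X i))) ⟨g', fun _ => rfl⟩ ?_ ⟨?_, ?_⟩
    · intro h
      exact hi (sgnR_eq_zero.1 (congrFun h i))
    · intro k hk h0
      apply hk
      rw [hf, sgnR_eq_zero] at h0
      exact sgnR_eq_zero.2 (hg'0 k h0)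
    · intro h
      have : j ∈ supp s := hj
      exact h this (sgnR_eq_zero.2 hg'j)
  · rw [Submodule.span_le]
    rintro _ ⟨i, hi, rfl⟩
    simpa using hi

lemma lattice_orth {n d : ℕ} (hd : 2 ≤ d) (X : Fin n → Fin d → ℝ)
    (hX : Submodule.span ℝ (Set.range X) = ⊤) (hII : ConditionII X) (y : Fin n → ℝ)
    (hy : ∑ i, y i • X i = 0) (j : Fin n) (hj : y j ≠ 0)
    (hmin : ∀ h : Fin n → ℝ, ∑ i, h i • X i = 0 → h ≠ 0 → (∀ i, y i = 0 → h i = 0) →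
      ∀ i, h i = 0 → y i = 0) (v : Fin n → ℤ) (hv : v ∈ cocircuitLattice X) :
    ∑ i, sgnR (y i) * v i = 0 := by
  classical
  have hC : LinearIndepOn ℝ X {i | y i ≠ 0 ∧ i ≠ j} := by
    rw [linearIndepOn_iff'']
    intro t g ht hg hsum i hi
    by_contra hgi
    have h1 : ∑ i, g i • X i = 0 := by
      rw [← hsum]
      symm
      apply Finset.sum_subset (Finset.subset_univ _)
      intro k _ hk
      simp [hg k hk]
    refine hj (hmin g h1 (fun h => hgi (congrFun h i)) ?_ j ?_)
    · intro k hk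
      apply hg
      intro hkt
      exact (ht hkt).1 hk
    · apply hg
      intro hkt
      exact (ht hkt).2 rfl
  obtain ⟨B, -, hCB, hBs, hB⟩ := exists_linearIndepOn_extension hC (Set.subset_univ _)
  have hBs' : Submodule.span ℝ (X '' B) = ⊤ := by
    rw [← top_le_iff, ← hX, Submodule.span_le, ← Set.image_univ]
    exact hBs
  have hyB : ∀ i, y i ≠ 0 → i = j ∨ i ∈ B := by
    intro i hi
    by_cases hij : i = j
    · exact Or.inl hij
    · exact Or.inr (hCB ⟨hi, hij⟩)
  have hjB : j ∉ B := by
    intro hjB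
    rw [linearIndepOn_iff'] at hB
    refine hj (hB (Finset.univ.filter (fun i => y i ≠ 0)) y ?_ ?_ j (by simp [hj]))
    · intro i hi
      simp at hi
      rcases hyB i hi with rfl | h
      · exact hjB
      · exact h
    · rw [← hy]
      apply Finset.sum_subset (Finset.subset_univ _)
      intro k _ hk
      simp at hk
      simp [hk]
  unfold cocircuitLattice at hv
  induction hv using AddSubgroup.closure_induction with
  | mem s hs =>
    obtain ⟨f, hf, hfs, hsf⟩ := cocircuit_spanned hX hs
    simp only [hsf]
    exact orth hd X hII B hB hBs' y hy j hjB hyB _ f hf hfs le_rfl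
  | zero => simp
  | add a b _ _ ha hb => simp [mul_add, Finset.sum_add_distrib, ha, hb]
  | neg a _ ha => simp [ha]

lemma sign_lattice_covector {n d : ℕ} (hd : 2 ≤ d) (X : Fin n → Fin d → ℝ)
    (hX : Submodule.span ℝ (Set.range X) = ⊤) (hII : ConditionII X)
    (v : Fin n → ℤ) (hv : v ∈ cocircuitLattice X) :
    ∃ f : (Fin d → ℝ) →ₗ[ℝ] ℝ, ∀ i, Int.sign (v i) = sgnR (f (X i)) := by
  classical
  apply farkas
  intro u hu hpos
  by_contra hcon
  push Not at hcon
  obtain ⟨j, hj⟩ := hcon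
  have huj : u j ≠ 0 := left_ne_zero_of_mul hj
  let U : Submodule ℝ (Fin n → ℝ) := LinearMap.ker (Fintype.linearCombination ℝ X)
  have hU : ∀ c, c ∈ U ↔ ∑ i, c i • X i = 0 := by
    intro c; simp [U, Fintype.linearCombination_apply]
  obtain ⟨g, hg, hgj, hgu, hg0, hmin⟩ := lemB U _ u ((hU u).2 hu) j huj le_rfl
  have h0 := lattice_orth hd X hX hII g ((hU g).1 hg) j hgj
    (fun h hh => hmin h ((hU h).2 hh)) v hv
  have hnn : ∀ i, 0 ≤ g i * (v i : ℝ) := by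
    intro i
    by_cases hgi : g i = 0
    · simp [hgi]
    have hui : u i ≠ 0 := fun h => hgi (hg0 i h)
    have := mul_nonneg (hgu i) (hpos i)
    have h1 : 0 < u i * u i := mul_self_pos.2 hui
    by_contra hneg
    push Not at hneg
    nlinarith
  have hs : ∀ i, 0 ≤ sgnR (g i) * v i ∧ (g i * (v i : ℝ) ≠ 0 → sgnR (g i) * v i ≠ 0) := by
    intro i
    refine ⟨?_, ?_⟩
    · have := hnn i
      rcases lt_trichotomy (g i) 0 with h | h | h
      · have : (v i : ℝ) ≤ 0 := by
          by_contra h'; push Not at h'; nlinarith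
        have : v i ≤ 0 := by exact_mod_cast this
        rw [sgnR_neg h]; linarith
      · simp [h, sgnR_zero]
      · have : (0 : ℝ) ≤ v i := by
          by_contra h'; push Not at h'; nlinarith
        have : 0 ≤ v i := by exact_mod_cast this
        rw [sgnR_pos h]; linarith
    · intro h
      refine mul_ne_zero ?_ ?_
      · rw [Ne, sgnR_eq_zero]; exact left_ne_zero_of_mul h
      · have := right_ne_zero_of_mul h
        exact_mod_cast this
  rw [Finset.sum_eq_zero_iff_of_nonneg (fun i _ => (hs i).1)] at h0
  exact (hs j).2 (mul_ne_zero hgj (right_ne_zero_of_mul hj)) (h0 j (Finset.mem_univ _))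

lemma covector_sign_lattice {n d : ℕ} (X : Fin n → Fin d → ℝ) (f : (Fin d → ℝ) →ₗ[ℝ] ℝ) :
    ∃ v ∈ cocircuitLattice X, ∀ i, sgnR (f (X i)) = Int.sign (v i) := by
  classical
  let E : ((Fin d → ℝ) →ₗ[ℝ] ℝ) →ₗ[ℝ] (Fin n → ℝ) := LinearMap.pi fun i => LinearMap.applyₗ (X i)
  have hE : ∀ g i, E g i = g (X i) := fun g i => rfl
  have key : ∀ j, ∃ w ∈ cocircuitLattice X, (∀ i, 0 < f (X i) → 0 ≤ w i) ∧
      (∀ i, f (X i) < 0 → w i ≤ 0) ∧ (∀ i, f (X i) = 0 → w i = 0) ∧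
      (f (X j) ≠ 0 → w j ≠ 0) := by
    intro j
    by_cases hj : f (X j) = 0
    · exact ⟨0, zero_mem _, by simp, by simp, by simp, by simp [hj]⟩
    obtain ⟨g, ⟨φ, rfl⟩, hgj, hgu, hg0, hmin⟩ := lemB (LinearMap.range E) _ (E f) ⟨f, rfl⟩ j hj le_rfl
    simp only [hE] at hgj hgu hg0 hmin
    refine ⟨fun i => sgnR (φ (X i)), AddSubgroup.subset_closure ⟨⟨φ, fun _ => rfl⟩, ?_, ?_⟩, ?_, ?_, ?_, ?_⟩
    · intro h
      exact hgj (sgnR_eq_zero.1 (congrFun h j))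
    · rintro t ⟨ψ, hψ⟩ ht ⟨hsub, hnsub⟩
      apply hnsub
      intro i hi hti
      rw [hψ, sgnR_eq_zero] at hti
      apply hi
      rw [sgnR_eq_zero]
      refine hmin (E ψ) ⟨ψ, rfl⟩ ?_ ?_ i hti
      · intro h
        apply ht
        funext k
        rw [hψ]
        exact sgnR_eq_zero.2 (congrFun h k)
      · intro k hk
        by_contra hne
        have : k ∈ supp t := by
          show t k ≠ 0
          rw [hψ, Ne, sgnR_eq_zero]; exact hne
        exact hsub this (sgnR_eq_zero.2 hk)
    · intro i hi
      have := hgu i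
      have h1 : 0 ≤ φ (X i) := by
        by_contra h; push Not at h; nlinarith
      simp only [sgnR]
      split_ifs <;> first | omega | linarith
    · intro i hi
      have := hgu i
      have h1 : φ (X i) ≤ 0 := by
        by_contra h; push Not at h; nlinarith
      simp only [sgnR]
      split_ifs <;> first | omega | linarith
    · intro i hi
      exact sgnR_eq_zero.2 (hg0 i hi)
    · intro _
      rw [Ne, sgnR_eq_zero]; exact hgj
  choose w hw h1 h2 h3 h4 using key
  refine ⟨∑ j, w j, sum_mem fun j _ => hw j, fun i => ?_⟩
  rw [Finset.sum_apply]
  rcases lt_trichotomy (f (X i)) 0 with h | h | h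
  · rw [sgnR_neg h, Int.sign_eq_neg_one_of_neg]
    refine Finset.sum_neg' (fun j _ => h2 j i h) ⟨i, Finset.mem_univ _, ?_⟩
    exact lt_of_le_of_ne (h2 i i h) (h4 i h.ne)
  · rw [h, sgnR_zero, Finset.sum_eq_zero (fun j _ => h3 j i h)]; rfl
  · rw [sgnR_pos h, Int.sign_eq_one_of_pos]
    refine Finset.sum_pos' (fun j _ => h1 j i h) ⟨i, Finset.mem_univ _, ?_⟩
    exact lt_of_le_of_ne (h1 i i h) (h4 i h.ne').symm

/-- If `X` spans `ℝ^d` (`d ≥ 2`) and satisfies McMullen's condition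
(II), then the covectors of `X` are exactly the sign vectors of the lattice
generated by the cocircuits of `X`. -/
theorem covectors_eq_signVectors_cocircuitLattice {n d : ℕ} (hd : 2 ≤ d)
    (X : Fin n → Fin d → ℝ) (hX : Submodule.span ℝ (Set.range X) = ⊤)
    (hII : ConditionII X) :
    {s : Fin n → ℤ | IsCovector X s} =
      {s : Fin n → ℤ | ∃ v ∈ cocircuitLattice X, s = fun i => Int.sign (v i)} := by
  ext s
  constructor
  · rintro ⟨f, hf⟩
    obtain ⟨v, hv, h⟩ := covector_sign_lattice X f
    exact ⟨v, hv, funext fun i => (hf i).trans (h i)⟩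
  · rintro ⟨v, hv, rfl⟩
    exact sign_lattice_covector hd X hX hII v hv
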